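/- Fix a point (c,e) in the two-torus T² = S¹ × S¹, an angle φ ∈ S¹, and ε > 0. Then for all but finitely many θ ∈ S¹, and for every d ∈ S¹, there exists a natural number n such that the n-th iterate of the rotation of T² by (φ,θ) applied to (c,d) lies in the open box (c−ε, c+ε) × (e−ε, e+ε). -/

import Mathlib

open Filter Topology Finset

/-- The nonnegative trigonometric polynomial `|(1 + z) / 2| ^ (2 * N)` on the unit circle. -/
noncomputable def cosKernel (N : ℕ) (z : Circle) : ℝ := (‖(1 + z : ℂ)‖ ^ 2 / 4) ^ N

/-- The Fourier coefficients of `cosKernel N`, shifted by `N`. -/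
noncomputable def cosCoeff (N j : ℕ) : ℝ := (2 * N).choose j / 4 ^ N

lemma cosKernel_nonneg (N : ℕ) (z : Circle) : 0 ≤ cosKernel N z := by
  unfold cosKernel; positivity

lemma cosCoeff_nonneg (N j : ℕ) : 0 ≤ cosCoeff N j := by
  unfold cosCoeff; positivity

lemma cosCoeff_self_pos (N : ℕ) : 0 < cosCoeff N N := by
  have : 0 < (2 * N).choose N := Nat.choose_pos (by omega)
  unfold cosCoeff; positivity

lemma cosKernel_eq_sum (N : ℕ) (z : Circle) :
    (cosKernel N z : ℂ) =
      ∑ j ∈ range (2 * N + 1), (cosCoeff N j : ℂ) * (z ^ ((j : ℤ) - N) : Circle) := by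
  have hz : (z : ℂ) ≠ 0 := z.coe_ne_zero
  have h : ((‖(1 + z : ℂ)‖ ^ 2 : ℝ) : ℂ) = (1 + z) ^ 2 * (z : ℂ)⁻¹ := by
    rw [← Complex.normSq_eq_norm_sq, Complex.normSq_eq_conj_mul_self, map_add, map_one,
      ← Circle.coe_inv_eq_conj, Circle.coe_inv]
    field_simp
    ring
  unfold cosKernel cosCoeff
  push_cast at h ⊢
  rw [h, div_pow, mul_pow, ← pow_mul, add_comm, add_pow, sum_mul, sum_div]
  refine sum_congr rfl fun j _ ↦ ?_
  rw [zpow_sub₀ hz, zpow_natCast, zpow_natCast]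
  field_simp
  simp

open scoped Classical in
lemma tendsto_average_circle_pow (z : Circle) :
    Tendsto (fun T : ℕ ↦ (∑ n ∈ range T, ((z ^ n : Circle) : ℂ)) / T) atTop
      (𝓝 (if z = 1 then 1 else 0)) := by
  split_ifs with h
  · refine tendsto_const_nhds.congr' ?_
    filter_upwards [eventually_ne_atTop 0] with T hT
    simp [h, hT]
  · have hz : (z : ℂ) ≠ 1 := by rwa [Ne, Circle.coe_eq_one]
    refine squeeze_zero_norm (a := fun T : ℕ ↦ 2 / ‖(z : ℂ) - 1‖ / T) (fun T ↦ ?_)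
      (tendsto_const_div_atTop_nhds_zero_nat _)
    rw [norm_div, RCLike.norm_natCast]
    gcongr
    simp only [Circle.coe_pow]
    rw [geom_sum_eq hz, norm_div]
    gcongr
    refine (norm_sub_le _ _).trans ?_
    rw [norm_pow, Circle.norm_coe]
    norm_num

open scoped Classical in
/-- If `w ^ a * v ^ b ≠ 1` for all `|a| ≤ M` and `0 < |b| ≤ N`, then in the orbit averages of the
product of the two kernels only the Fourier modes independent of the second variable survive. -/
lemma tendsto_average_cosKernel_mul {w v : Circle} (s : Circle) {M N : ℕ}
    (h : ∀ j ∈ range (2 * M + 1), ∀ k ∈ range (2 * N + 1), k ≠ N →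
      w ^ ((j : ℤ) - M) * v ^ ((k : ℤ) - N) ≠ 1) :
    Tendsto (fun T : ℕ ↦
        (∑ n ∈ range T, cosKernel M (w ^ n) * cosKernel N (s * v ^ n)) / T) atTop
      (𝓝 (cosCoeff N N *
        ∑ j ∈ range (2 * M + 1), cosCoeff M j * if w ^ ((j : ℤ) - M) = 1 then 1 else 0)) := by
  have key : Tendsto (fun T : ℕ ↦ ∑ j ∈ range (2 * M + 1), ∑ k ∈ range (2 * N + 1),
        (cosCoeff M j * cosCoeff N k * (s ^ ((k : ℤ) - N) : Circle) : ℂ) *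
        ((∑ n ∈ range T, (((w ^ ((j : ℤ) - M) * v ^ ((k : ℤ) - N)) ^ n : Circle) : ℂ)) / T)) atTop
      (𝓝 (∑ j ∈ range (2 * M + 1), ∑ k ∈ range (2 * N + 1),
        (cosCoeff M j * cosCoeff N k * (s ^ ((k : ℤ) - N) : Circle) : ℂ) *
        if w ^ ((j : ℤ) - M) * v ^ ((k : ℤ) - N) = 1 then 1 else 0)) :=
    tendsto_finsetSum _ fun j _ ↦ tendsto_finsetSum _ fun k _ ↦
      (tendsto_average_circle_pow _).const_mul _
  rw [← Filter.tendsto_ofReal_iff]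
  convert key using 2 with T
  · push_cast
    simp_rw [mul_div, ← sum_div]
    congr 1
    simp_rw [mul_sum]
    rw [sum_congr rfl fun j _ ↦ sum_comm, sum_comm]
    refine sum_congr rfl fun n _ ↦ ?_
    rw [cosKernel_eq_sum, cosKernel_eq_sum, sum_mul_sum]
    refine sum_congr rfl fun j _ ↦ sum_congr rfl fun k _ ↦ ?_
    rw [mul_zpow, ← zpow_natCast w, ← zpow_natCast v, zpow_comm w, zpow_comm v]
    push_cast
    simp only [zpow_natCast]
    ring
  · push_cast
    rw [mul_sum]
    refine sum_congr rfl fun j hj ↦ ?_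
    rw [sum_eq_single_of_mem N (by simp; omega)
      fun k hk hkN ↦ by rw [if_neg (h j hj k hk hkN), mul_zero]]
    split_ifs <;> simp_all [mul_comm]

open scoped Classical in
lemma exists_cosKernel_mul_gt {w v : Circle} (s : Circle) {N : ℕ} {η : ℝ}
    (hη : 2 * η < cosCoeff N N)
    (h : ∀ j ∈ range (2 * N + 1), ∀ k ∈ range (2 * N + 1), k ≠ N →
      w ^ ((j : ℤ) - N) * v ^ ((k : ℤ) - N) ≠ 1) :
    ∃ n : ℕ, η < cosKernel N (w ^ n) ∧ η < cosKernel N (s * v ^ n) := by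
  by_contra! hn
  set F := ∑ j ∈ range (2 * N + 1), cosCoeff N j * if w ^ ((j : ℤ) - N) = 1 then 1 else 0 with hF
  have hcF : cosCoeff N N ≤ F := by
    refine le_trans ?_ (single_le_sum (f := fun j ↦
      cosCoeff N j * if w ^ ((j : ℤ) - N) = 1 then 1 else 0)
      (fun j _ ↦ mul_nonneg (cosCoeff_nonneg N j) (by split_ifs <;> simp)) (a := N)
      (by simp; omega))
    simp
  have h_prod := tendsto_average_cosKernel_mul s h
  have h_fst := tendsto_average_cosKernel_mul (w := w) (v := v) s (M := N) (N := 0) (by simp)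
  have h_snd := tendsto_average_cosKernel_mul (w := w) (v := v) s (M := 0) (N := N)
    fun j hj k hk hkN ↦ by
      simpa [show j = 0 by simpa using hj] using h N (by simp; omega) k hk hkN
  rw [← hF] at h_prod h_fst
  have h_le := le_of_tendsto_of_tendsto' h_prod ((h_fst.const_mul η).add (h_snd.const_mul η))
    fun T ↦ by
      rw [mul_div, mul_div, ← add_div, mul_sum, mul_sum, ← sum_add_distrib]
      gcongr with n
      have hf := cosKernel_nonneg N (w ^ n)
      have hg := cosKernel_nonneg N (s * v ^ n)
      have h0 (z : Circle) : cosKernel 0 z = 1 := by simp [cosKernel]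
      simp only [h0, mul_one, one_mul]
      by_cases hle : cosKernel N (w ^ n) ≤ η
      · nlinarith [mul_le_mul_of_nonneg_right hle hg,
          mul_nonneg ((cosKernel_nonneg N _).trans hle) hf]
      · have hle' := hn n (not_le.1 hle)
        nlinarith [mul_le_mul_of_nonneg_left hle' hf, mul_nonneg (hg.trans hle') hg]
  have hc := cosCoeff_self_pos N
  have h00 : cosCoeff 0 0 = 1 := by simp [cosCoeff]
  simp [h00] at h_le
  nlinarith

lemma exists_norm_one_add_toCircle_le {ε : ℝ} (hε : 0 < ε) :
    ∃ r : ℝ, 0 ≤ r ∧ r < 1 ∧ ∀ x : AddCircle (1 : ℝ), ε ≤ ‖x‖ →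
      ‖(1 + x.toCircle : ℂ)‖ ^ 2 / 4 ≤ r := by
  have hcont : Continuous fun x : AddCircle (1 : ℝ) ↦ ‖(1 + x.toCircle : ℂ)‖ ^ 2 / 4 := by
    have := AddCircle.continuous_toCircle (T := 1)
    fun_prop
  have hcomp : IsCompact {x : AddCircle (1 : ℝ) | ε ≤ ‖x‖} :=
    (isClosed_le continuous_const continuous_norm).isCompact
  rcases Set.eq_empty_or_nonempty {x : AddCircle (1 : ℝ) | ε ≤ ‖x‖} with he | hne
  · exact ⟨0, le_rfl, one_pos, fun x hx ↦ (Set.eq_empty_iff_forall_notMem.1 he x hx).elim⟩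
  obtain ⟨x, hx, hmax⟩ := hcomp.exists_isMaxOn hne hcont.continuousOn
  refine ⟨_, by positivity, ?_, hmax⟩
  have hx1 : (x.toCircle : ℂ) ≠ 1 := by
    rw [Ne, Circle.coe_eq_one, ← AddCircle.toCircle_zero,
      (AddCircle.injective_toCircle one_ne_zero).eq_iff]
    rintro rfl
    simp at hx
    linarith
  have hpar := parallelogram_law_with_norm ℝ (1 : ℂ) x.toCircle
  have : 0 < ‖(1 - x.toCircle : ℂ)‖ := norm_pos_iff.2 (sub_ne_zero.2 hx1.symm)
  simp only [norm_one, Circle.norm_coe] at hpar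
  nlinarith

lemma exists_two_mul_pow_lt_cosCoeff {r : ℝ} (h0 : 0 ≤ r) (h1 : r < 1) :
    ∃ N : ℕ, 2 * r ^ N < cosCoeff N N := by
  have ht := (tendsto_self_mul_const_pow_of_lt_one h0 h1).const_mul 4
  rw [mul_zero] at ht
  obtain ⟨N, hN, hN0⟩ := ((ht.eventually_lt_const one_pos).and (eventually_gt_atTop 0)).exists
  refine ⟨N, ?_⟩
  have hb : (4 : ℝ) ^ N ≤ 2 * N * (2 * N).choose N := by
    exact_mod_cast Nat.four_pow_le_two_mul_self_mul_centralBinom N hN0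
  have hC : (0 : ℝ) < (2 * N).choose N := by exact_mod_cast Nat.choose_pos (by omega)
  rw [cosCoeff, lt_div_iff₀ (by positivity)]
  have : 0 ≤ r ^ N := by positivity
  nlinarith [mul_le_mul_of_nonneg_left hb this]

lemma Circle.finite_setOf_zpow_eq {k : ℤ} (hk : k ≠ 0) (u : Circle) :
    {v : Circle | v ^ k = u}.Finite := by
  have hnat {m : ℕ} (hm : 0 < m) (u : Circle) : {v : Circle | v ^ m = u}.Finite := by
    refine Set.Finite.of_finite_image (f := ((↑) : Circle → ℂ)) ?_ Circle.coe_injective.injOn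
    refine ((Polynomial.nthRoots m (u : ℂ)).toFinset.finite_toSet).subset ?_
    rintro _ ⟨v, rfl, rfl⟩
    simp [Polynomial.mem_nthRoots hm]
  rcases Int.natAbs_eq k with h | h
  · rw [h]
    simpa only [zpow_natCast] using hnat (Int.natAbs_pos.2 hk) u
  · rw [h]
    simpa only [zpow_neg, zpow_natCast, inv_eq_iff_eq_inv] using hnat (Int.natAbs_pos.2 hk) u⁻¹

/-- Quantitative Kronecker: fix `(c,e)` in the 2-torus, an angle `φ` and `ε > 0`.
For all but finitely many `θ`, for every `d`, some iterate of the rotation by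
`(φ,θ)` brings `(c,d)` within `ε` of `(c,e)` in each coordinate. -/
theorem stmt0 (c e φ : AddCircle (1 : ℝ)) (ε : ℝ) (hε : 0 < ε) :
    {θ : AddCircle (1 : ℝ) |
      ¬ ∀ d : AddCircle (1 : ℝ), ∃ n : ℕ,
        dist (c + n • φ) c < ε ∧ dist (d + n • θ) e < ε}.Finite := by
  obtain ⟨r, hr0, hr1, hr⟩ := exists_norm_one_add_toCircle_le hε
  obtain ⟨N, hN⟩ := exists_two_mul_pow_lt_cosCoeff hr0 hr1
  have hnear {x : AddCircle (1 : ℝ)} (hx : r ^ N < cosKernel N x.toCircle) : ‖x‖ < ε := by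
    by_contra! hle
    exact hx.not_ge (pow_le_pow_left₀ (by positivity) (hr x hle) N)
  have hfin : (⋃ j ∈ range (2 * N + 1), ⋃ k ∈ (range (2 * N + 1)).erase N,
      AddCircle.toCircle (T := 1) ⁻¹'
        {v | v ^ ((k : ℤ) - N) = (φ.toCircle ^ ((j : ℤ) - N))⁻¹}).Finite := by
    refine (range _).finite_toSet.biUnion fun j _ ↦ (finite_toSet _).biUnion fun k hk ↦
      (Circle.finite_setOf_zpow_eq ?_ _).preimage
        (AddCircle.injective_toCircle one_ne_zero).injOn
    have : k ≠ N := by simp_all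
    omega
  refine hfin.subset fun θ hθ ↦ ?_
  by_contra h_notMem
  refine hθ fun d ↦ ?_
  obtain ⟨n, hn1, hn2⟩ := exists_cosKernel_mul_gt (w := φ.toCircle) (v := θ.toCircle)
    (d - e).toCircle hN fun j hj k hk hkN h ↦ h_notMem <| by
      simp only [Set.mem_iUnion]
      exact ⟨j, hj, k, mem_erase.2 ⟨hkN, hk⟩, (inv_eq_of_mul_eq_one_right h).symm⟩
  rw [← AddCircle.toCircle_nsmul] at hn1 hn2
  rw [← AddCircle.toCircle_add] at hn2
  refine ⟨n, ?_, ?_⟩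
  · simpa [dist_eq_norm] using hnear hn1
  · rw [dist_eq_norm, add_sub_right_comm]
    exact hnear hn2
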